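/- (Matrix-Tree Theorem) Let G be a finite simple graph on n ≥ 2 vertices v_1, …, v_n with Laplacian matrix L. Then for any 1 ≤ i, j ≤ n, τ(G) = (−1)^(i+j) · det(L_{i,j}), where L_{i,j} is the (n−1) × (n−1) matrix obtained from L by deleting the i-th row and the j-th column. -/

import Mathlib

/-- The number of spanning trees of a finite simple graph `G`. -/
noncomputable def tau {V : Type} [Fintype V] (G : SimpleGraph V) : ℕ :=
  Nat.card {H : SimpleGraph V // H ≤ G ∧ H.IsTree}

/-- The degree of a vertex. -/
noncomputable def deg {V : Type} (G : SimpleGraph V) (x : V) : ℕ :=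
  (G.neighborSet x).ncard

/- The Laplacian matrix of a finite simple graph on `Fin n`. -/
open Classical in
noncomputable def lap {n : ℕ} (G : SimpleGraph (Fin n)) : Matrix (Fin n) (Fin n) ℝ :=
  Matrix.of fun i j => if i = j then (deg G i : ℝ) else if G.Adj i j then -1 else 0

/-- A parent map on the vertices other than `r` is rooted at `r` when some height function strictly
decreases from each vertex to its parent. -/
def IsRooted {V : Type*} (r : V) (f : {v : V // v ≠ r} → V) : Prop :=
  ∃ d : V → ℕ, ∀ i, d (f i) < d i

/-- The row of the parent map matrix: `e_i - e_{k}`, restricted to the vertices other than `r`. -/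
def parentRow {V : Type*} [DecidableEq V] (r : V) (i : {v : V // v ≠ r}) (k : V) :
    {v : V // v ≠ r} → ℝ :=
  fun j => (if i = j then 1 else 0) - (if k = j then 1 else 0)

theorem det_parentRow_of_isRooted {V : Type*} [Fintype V] [DecidableEq V] {r : V}
    {f : {v : V // v ≠ r} → V} (hf : IsRooted r f) :
    (Matrix.of fun i => parentRow r i (f i)).det = 1 := by
  obtain ⟨d, hd⟩ := hf
  have hzero : ∀ i j : {v : V // v ≠ r}, d i ≤ d j → f i ≠ j := by
    intro i j hij h
    have := hd i
    rw [h] at this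
    omega
  have htri : (Matrix.of fun i => parentRow r i (f i)).BlockTriangular
      (fun i => OrderDual.toDual (d i)) := by
    intro i j hij
    have hij' : d i < d j := hij
    have hne : i ≠ j := fun h => by simp [h] at hij'
    simp [parentRow, hne, hzero i j hij'.le]
  rw [htri.det]
  refine Finset.prod_eq_one fun a _ => ?_
  suffices h : (Matrix.of fun i => parentRow r i (f i)).toSquareBlock
      (fun i => OrderDual.toDual (d i)) a = 1 by rw [h, Matrix.det_one]
  ext ⟨i, hi⟩ ⟨j, hj⟩
  have hij : d i = d j := OrderDual.toDual.injective (hi.trans hj.symm)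
  simp [Matrix.toSquareBlock, Matrix.toSquareBlockProp, parentRow, Matrix.one_apply,
    hzero i j hij.le]

theorem isRooted_of_forall_exists_iterate {V : Type*} {r : V} {f : {v : V // v ≠ r} → V}
    {F : V → V} (hF : ∀ i : {v : V // v ≠ r}, F i = f i)
    (h : ∀ v, ∃ k, F^[k] v = r) : IsRooted r f := by
  classical
  refine ⟨fun v => Nat.find (h v), fun i => ?_⟩
  have hspec := Nat.find_spec (h i)
  rcases hk : Nat.find (h i) with _ | k
  · rw [hk] at hspec
    exact absurd hspec i.2
  · rw [hk, Function.iterate_succ_apply, hF] at hspec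
    simp only [hk]
    exact Nat.lt_succ_of_le (Nat.find_min' (h (f i)) hspec)

theorem det_parentRow_of_not_isRooted {V : Type*} [Fintype V] [DecidableEq V] {r : V}
    {f : {v : V // v ≠ r} → V} (hf : ¬ IsRooted r f) :
    (Matrix.of fun i => parentRow r i (f i)).det = 0 := by
  classical
  let F : V → V := fun v => if h : v ≠ r then f ⟨v, h⟩ else r
  have hF : ∀ i : {v : V // v ≠ r}, F i = f i := fun i => by simp [F, i.2]
  let R : V → Prop := fun v => ∃ k, F^[k] v = r
  have hr : R r := ⟨0, rfl⟩
  have hR : ∀ i : {v : V // v ≠ r}, R (f i) ↔ R i := by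
    intro i
    constructor
    · rintro ⟨k, hk⟩
      exact ⟨k + 1, by rwa [Function.iterate_succ_apply, hF]⟩
    · rintro ⟨_ | k, hk⟩
      · exact absurd hk i.2
      · exact ⟨k, by rwa [Function.iterate_succ_apply, hF] at hk⟩
  let x : V → ℝ := fun v => if R v then 0 else 1
  have hxr : x r = 0 := if_pos hr
  rw [← Matrix.exists_mulVec_eq_zero_iff]
  refine ⟨fun i => x i, fun hx => hf (isRooted_of_forall_exists_iterate hF fun v => ?_), ?_⟩
  · by_cases hv : v = r
    · rw [hv]
      exact hr
    · by_contra hv'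
      have := congrFun hx ⟨v, hv⟩
      simp only [x, Pi.zero_apply] at this
      rw [if_neg hv'] at this
      exact one_ne_zero this
  · ext i
    have hsum : ∑ j : {v : V // v ≠ r}, (if f i = j then x j else 0) = x (f i) := by
      by_cases h : f i = r
      · rw [h, hxr]
        exact Finset.sum_eq_zero fun j _ => if_neg (Ne.symm j.2)
      · rw [Finset.sum_eq_single ⟨f i, h⟩]
        · simp
        · intro j _ hj
          exact if_neg fun h' => hj (Subtype.ext h'.symm)
        · simp
    have hx : x (f i) = x i := by simp only [x, hR]
    simp only [Matrix.mulVec, dotProduct, Matrix.of_apply, parentRow, sub_mul, ite_mul, one_mul,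
      zero_mul, Finset.sum_sub_distrib, hsum, hx]
    simp

/-- The graph whose edges join each vertex other than `r` to its parent. -/
def parentGraph {V : Type*} (r : V) (f : {v : V // v ≠ r} → V) : SimpleGraph V :=
  SimpleGraph.fromEdgeSet (Set.range fun i : {v : V // v ≠ r} => s((i : V), f i))

theorem parentGraph_adj {V : Type*} {r : V} {f : {v : V // v ≠ r} → V} (hf : IsRooted r f)
    (i : {v : V // v ≠ r}) : (parentGraph r f).Adj i (f i) := by
  obtain ⟨d, hd⟩ := hf
  refine (SimpleGraph.fromEdgeSet_adj _).2 ⟨⟨i, rfl⟩, fun h => ?_⟩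
  have := hd i
  rw [← h] at this
  exact this.false

theorem parentGraph_le {V : Type*} {r : V} {f : {v : V // v ≠ r} → V} {G : SimpleGraph V}
    (h : ∀ i : {v : V // v ≠ r}, G.Adj i (f i)) : parentGraph r f ≤ G := by
  rw [parentGraph, SimpleGraph.fromEdgeSet_le]
  rintro _ ⟨⟨i, rfl⟩, -⟩
  exact h i

theorem parentGraph_connected {V : Type*} {r : V} {f : {v : V // v ≠ r} → V}
    (hf : IsRooted r f) : (parentGraph r f).Connected := by
  have hadj := parentGraph_adj hf
  obtain ⟨d, hd⟩ := hf
  have key : ∀ n v, d v = n → (parentGraph r f).Reachable v r := by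
    intro n
    induction n using Nat.strong_induction_on with
    | _ n ih =>
      intro v hv
      by_cases h : v = r
      · rw [h]
      · exact (hadj ⟨v, h⟩).reachable.trans (ih _ (hv ▸ hd ⟨v, h⟩) _ rfl)
  exact (SimpleGraph.connected_iff_exists_forall_reachable _).2 ⟨r, fun v => (key _ v rfl).symm⟩

theorem parentGraph_isTree {V : Type*} [Finite V] {r : V} {f : {v : V // v ≠ r} → V}
    (hf : IsRooted r f) : (parentGraph r f).IsTree := by
  classical
  have := Fintype.ofFinite V
  have hc := parentGraph_connected hf
  refine SimpleGraph.isTree_iff_connected_and_card.2 ⟨hc, le_antisymm ?_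
    hc.card_vert_le_card_edgeSet_add_one⟩
  have h1 : Nat.card (parentGraph r f).edgeSet ≤ Nat.card {v : V // v ≠ r} := by
    have hsub : (parentGraph r f).edgeSet ⊆
        Set.range fun i : {v : V // v ≠ r} => s((i : V), f i) := by
      rw [parentGraph, SimpleGraph.edgeSet_fromEdgeSet]
      exact Set.sdiff_subset
    exact (Nat.card_mono (Set.toFinite _) hsub).trans (Finite.card_range_le _)
  have h2 : Nat.card {v : V // v ≠ r} + 1 = Nat.card V := by
    have hpos : 0 < Fintype.card V := Fintype.card_pos_iff.2 ⟨r⟩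
    simp only [Nat.card_eq_fintype_card, ne_eq, Fintype.card_subtype_compl,
      Fintype.card_subtype_eq]
    omega
  omega

theorem parentGraph_injOn {V : Type*} (r : V) :
    Set.InjOn (parentGraph r) {f | IsRooted r f} := by
  intro f hf g hg hfg
  have hadj := parentGraph_adj hf
  obtain ⟨d, hd⟩ := hf
  have key : ∀ n (i : {v : V // v ≠ r}), d i = n → f i = g i := by
    intro n
    induction n using Nat.strong_induction_on with
    | _ n ih =>
      intro i hi
      have h := hadj i
      rw [hfg, parentGraph, SimpleGraph.fromEdgeSet_adj] at h
      obtain ⟨⟨j, hj⟩, -⟩ := h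
      rcases Sym2.eq_iff.1 hj with ⟨h1, h2⟩ | ⟨h1, h2⟩
      · rw [← h2, Subtype.ext h1]
      · have hlt : d j < d i := by rw [h1]; exact hd i
        have h3 := ih _ (hi ▸ hlt) j rfl
        have h4 := hd j
        rw [h3, h2] at h4
        omega
  exact funext fun i => key _ i rfl

theorem exists_parentGraph_eq {V : Type*} (r : V) {T : SimpleGraph V} (hT : T.IsTree) :
    ∃ f : {v : V // v ≠ r} → V, IsRooted r f ∧ (∀ i : {v : V // v ≠ r}, T.Adj i (f i)) ∧
      parentGraph r f = T := by
  have hex : ∀ i : {v : V // v ≠ r}, ∃ w, T.Adj i w ∧ T.dist w r < T.dist i r := by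
    rintro ⟨v, hv⟩
    obtain ⟨p, hp⟩ := hT.connected.exists_walk_length_eq_dist v r
    cases p with
    | nil => exact absurd rfl hv
    | cons h q =>
      refine ⟨_, h, (SimpleGraph.dist_le q).trans_lt ?_⟩
      rw [← hp, SimpleGraph.Walk.length_cons]
      exact Nat.lt_succ_self _
  choose f hf hd using hex
  have hroot : IsRooted r f := ⟨fun v => T.dist v r, hd⟩
  have hle := parentGraph_le hf
  exact ⟨f, hroot, hf, le_antisymm hle
    ((SimpleGraph.isTree_iff_minimal_connected.1 hT).2 (parentGraph_connected hroot) hle)⟩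

theorem tau_eq_card_isRooted {V : Type} [Fintype V] (G : SimpleGraph V) (r : V) :
    tau G = Nat.card {f : {v : V // v ≠ r} → V //
      (∀ i : {v : V // v ≠ r}, G.Adj i (f i)) ∧ IsRooted r f} := by
  refine (Nat.card_eq_of_bijective (fun f => ⟨parentGraph r f.1, parentGraph_le f.2.1,
    parentGraph_isTree f.2.2⟩) ⟨fun f g h => ?_, fun T => ?_⟩).symm
  · exact Subtype.ext (parentGraph_injOn r f.2.2 g.2.2 (congrArg Subtype.val h))
  · obtain ⟨f, hf, hadj, h⟩ := exists_parentGraph_eq r T.2.2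
    exact ⟨⟨f, fun i => T.2.1 (hadj i), hf⟩, Subtype.ext h⟩

theorem deg_eq_degree {V : Type} (G : SimpleGraph V) (v : V) [Fintype (G.neighborSet v)] :
    deg G v = G.degree v := by
  rw [deg, Set.ncard_eq_toFinset_card', Set.toFinset_card, SimpleGraph.card_neighborSet_eq_degree]

open Classical in
theorem lap_row_eq_sum_parentRow {n : ℕ} (G : SimpleGraph (Fin n)) (r : Fin n)
    (i : {v : Fin n // v ≠ r}) :
    (fun j : {v : Fin n // v ≠ r} => lap G i j) =
      ∑ k ∈ G.neighborFinset i, parentRow r i k := by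
  ext j
  simp only [Finset.sum_apply, parentRow, Finset.sum_sub_distrib, Finset.sum_const,
    SimpleGraph.card_neighborFinset_eq_degree, Finset.sum_ite_eq', lap, Matrix.of_apply,
    deg_eq_degree, SimpleGraph.mem_neighborFinset]
  by_cases h : i = j
  · subst h
    simp
  · have h' : (i : Fin n) ≠ j := fun h' => h (Subtype.ext h')
    by_cases ha : G.Adj i j <;> simp [h, h', ha]

theorem det_lap_eq_tau {n : ℕ} (G : SimpleGraph (Fin n)) (r : Fin n) :
    ((lap G).submatrix (Subtype.val : {v : Fin n // v ≠ r} → Fin n) Subtype.val).det = tau G := by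
  classical
  have hrows : (lap G).submatrix (Subtype.val : {v : Fin n // v ≠ r} → Fin n) Subtype.val =
      fun i : {v : Fin n // v ≠ r} => ∑ k ∈ G.neighborFinset i, parentRow r i k :=
    funext fun i => lap_row_eq_sum_parentRow G r i
  have hdet : ∀ f : {v : Fin n // v ≠ r} → Fin n,
      Matrix.detRowAlternating (fun i => parentRow r i (f i)) =
        if IsRooted r f then (1 : ℝ) else 0 := by
    intro f
    split_ifs with h
    · exact det_parentRow_of_isRooted h
    · exact det_parentRow_of_not_isRooted h
  rw [hrows]
  refine (Matrix.detRowAlternating.toMultilinearMap.map_sum_finset _ _).trans ?_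
  simp only [AlternatingMap.coe_multilinearMap, hdet]
  rw [Finset.sum_boole, tau_eq_card_isRooted G r, Nat.card_eq_fintype_card, Fintype.card_subtype]
  congr 2
  ext f
  simp

theorem sum_lap_row {n : ℕ} (G : SimpleGraph (Fin n)) (i : Fin n) : ∑ j, lap G i j = 0 := by
  classical
  have hsplit : ∀ j, lap G i j =
      (if i = j then (G.degree i : ℝ) else 0) - (if G.Adj i j then 1 else 0) := by
    intro j
    by_cases h : i = j
    · subst h
      simp [lap, deg_eq_degree]
    · by_cases ha : G.Adj i j <;> simp [lap, h, ha]
  simp only [hsplit, Finset.sum_sub_distrib, Finset.sum_ite_eq, Finset.mem_univ, if_true,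
    SimpleGraph.degree_eq_sum_if_adj, sub_self]

/-- Matrix-Tree Theorem: for a graph on `n + 1 ≥ 2` vertices with Laplacian `L`,
`τ(G) = (-1)^(i+j) · det(L with row i and column j deleted)` for any `i, j`. -/
theorem stmt9 (n : ℕ) (hn : 1 ≤ n) (G : SimpleGraph (Fin (n + 1)))
    (i j : Fin (n + 1)) :
    (tau G : ℝ) =
      (-1 : ℝ) ^ ((i : ℕ) + (j : ℕ)) *
        ((lap G).submatrix i.succAbove j.succAbove).det := by
  have hdiag : ((lap G).submatrix i.succAbove i.succAbove).det = tau G := by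
    rw [← det_lap_eq_tau G i, ← Matrix.det_submatrix_equiv_self (finSuccAboveEquiv i)]
    rfl
  have h := Matrix.submatrix_succAbove_det_eq_negOnePow_submatrix_succAbove_det'
    ((lap G).submatrix i.succAbove id) (fun k => sum_lap_row G _) i j
  simp only [Matrix.submatrix_submatrix, Function.id_comp, Function.comp_id] at h
  rw [hdiag] at h
  rw [h, Int.negOnePow_sub, ← Int.negOnePow_add, ← Nat.cast_add, Units.smul_def,
    Int.coe_negOnePow_natCast, zsmul_eq_mul]
  push_cast
  rfl
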